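/- Let V and V′ be simple, central, Ḡ-graded left R-modules whose associated G-pregradings are thin. Suppose there is an isomorphism of G-graded left R-modules φ: L_π(V) → L_π(V′) such that conjugation by φ maps the subalgebra span{δ_h : h ∈ H} of C(L_π(V)) onto the subalgebra span{δ′_h : h ∈ H} of C(L_π(V′)), where δ_h (respectively δ′_h) denotes the endomorphism v_ḡ ⊗ g ↦ v_ḡ ⊗ gh. Then there exists a character χ: H → F^× such that V′ is isomorphic to the twisted module V^χ as a Ḡ-graded left R-module. -/

import Mathlib

/-! Common definitions: gradings on algebras and modules, graded simplicity,
homogeneous endomorphisms, graded subfields, and loop modules. -/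

noncomputable section

namespace GradedPaper

variable {F : Type*} [Field F]

/-- `ℳ` is a direct sum decomposition of the `F`-vector space `V`:
every vector is a finite sum of homogeneous components, and such
decompositions are unique (independence). -/
def IsVSDecomp {V ι : Type*} [AddCommGroup V] [Module F V]
    (ℳ : ι → Submodule F V) : Prop :=
  (∀ v : V, ∃ (t : Finset ι) (c : ι → V), (∀ i ∈ t, c i ∈ ℳ i) ∧ v = ∑ i ∈ t, c i) ∧
  (∀ (t : Finset ι) (c : ι → V), (∀ i ∈ t, c i ∈ ℳ i) → ∑ i ∈ t, c i = 0 →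
    ∀ i ∈ t, c i = 0)

/-- A `G`-grading on a unital associative `F`-algebra `R`:
`R = ⊕_{g ∈ G} R_g` with `1 ∈ R_0` and `R_g · R_h ⊆ R_{g+h}`.
(The abelian grading group is written additively.) -/
structure AlgebraGrading (F : Type*) [Field F] (G : Type*) [AddCommGroup G]
    (R : Type*) [Ring R] [Algebra F R] where
  comp : G → Submodule F R
  decomp : IsVSDecomp comp
  one_mem : (1 : R) ∈ comp 0
  mul_mem : ∀ {g h : G} {r s : R}, r ∈ comp g → s ∈ comp h → r * s ∈ comp (g + h)

variable {G : Type*} [AddCommGroup G] {R : Type*} [Ring R] [Algebra F R]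

/-- A grading of a left `R`-module `V` by the group `κ`, compatible with the
`G`-grading `𝒜` of `R` along the homomorphism `p : G →+ κ`
(so `R_g · V_k ⊆ V_{p g + k}`).  For `p = id` this is a `G`-graded module;
for `p : G →+ G ⧸ H` the natural projection, this is a `G/H`-graded module
(for the induced `G/H`-grading of `R`). -/
structure ModuleGrading (𝒜 : AlgebraGrading F G R) {κ : Type*} [AddCommGroup κ]
    (p : G →+ κ) (V : Type*) [AddCommGroup V] [Module F V] [Module R V]
    [IsScalarTower F R V] where
  comp : κ → Submodule F V
  decomp : IsVSDecomp comp
  smul_mem : ∀ {g : G} {k : κ} {r : R} {v : V},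
    r ∈ 𝒜.comp g → v ∈ comp k → r • v ∈ comp (p g + k)

/-- `W` is a graded submodule: every element of `W` is a finite sum of
homogeneous elements of `W`. -/
def IsGradedSubmodule {κ V : Type*} [AddCommGroup V] [Module F V] [Module R V]
    (ℳ : κ → Submodule F V) (W : Submodule R V) : Prop :=
  ∀ w ∈ W, ∃ (t : Finset κ) (c : κ → V),
    (∀ i ∈ t, c i ∈ ℳ i ∧ c i ∈ W) ∧ w = ∑ i ∈ t, c i

/-- The graded module with components `ℳ` is graded simple. -/
def IsGradedSimpleModule (R : Type*) [Ring R] {κ V : Type*} [AddCommGroup V]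
    [Module F V] [Module R V] (ℳ : κ → Submodule F V) : Prop :=
  (∃ v : V, v ≠ 0) ∧ ∀ W : Submodule R V, IsGradedSubmodule ℳ W → W = ⊥ ∨ W = ⊤

/-- An `R`-module endomorphism of `V` is homogeneous of degree `d`. -/
def IsHomogeneousEnd {κ V : Type*} [Add κ] [AddCommGroup V] [Module F V]
    [Module R V] (ℳ : κ → Submodule F V) (d : κ) (f : Module.End R V) : Prop :=
  ∀ ⦃k : κ⦄ ⦃v : V⦄, v ∈ ℳ k → f v ∈ ℳ (k + d)

/-- The degree-`d` homogeneous component of the (graded) centralizer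
`C(V) = End_R(V)`. -/
def homogComp {κ V : Type*} [Add κ] [AddCommGroup V] [Module F V] [Module R V]
    [SMulCommClass R F V] (ℳ : κ → Submodule F V) (d : κ) :
    Submodule F (Module.End R V) where
  carrier := {f | IsHomogeneousEnd ℳ d f}
  add_mem' := fun hf hg k v hv => (ℳ _).add_mem (hf hv) (hg hv)
  zero_mem' := fun k v hv => (ℳ _).zero_mem
  smul_mem' := fun c f hf k v hv => by
    simpa using (ℳ _).smul_mem c (hf hv)

/-- `f` belongs to the graded centralizer: it is a finite sum of homogeneous
`R`-module endomorphisms. -/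
def IsInGradedCentralizer {κ V : Type*} [Add κ] [AddCommGroup V] [Module F V]
    [Module R V] (ℳ : κ → Submodule F V) (f : Module.End R V) : Prop :=
  ∃ (t : Finset κ) (c : κ → Module.End R V),
    (∀ d ∈ t, IsHomogeneousEnd ℳ d (c d)) ∧ f = ∑ d ∈ t, c d

/-- The module `V` is central (Schurian): its centralizer consists of the
scalar multiples of the identity. -/
def IsCentralModule (F : Type*) [Field F] (R V : Type*) [Ring R] [AddCommGroup V]
    [Module F V] [Module R V] : Prop :=
  ∀ f : Module.End R V, ∃ a : F, ∀ v : V, f v = a • v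

/-- A graded subfield of a graded algebra with homogeneous components `𝒟`:
a graded unital subalgebra (given by its homogeneous components `comp`)
which is commutative and in which every nonzero homogeneous element is
invertible. -/
structure GradedSubfield {κ : Type*} [AddCommGroup κ] {A : Type*} [Ring A]
    [Module F A] (𝒟 : κ → Submodule F A) where
  comp : κ → Submodule F A
  le : ∀ k, comp k ≤ 𝒟 k
  one_mem : (1 : A) ∈ comp 0
  mul_mem : ∀ {g h : κ} {a b : A}, a ∈ comp g → b ∈ comp h → a * b ∈ comp (g + h)
  comm : ∀ {g h : κ} {a b : A}, a ∈ comp g → b ∈ comp h → a * b = b * a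
  inv_mem : ∀ {g : κ} {a : A}, a ∈ comp g → a ≠ 0 →
    ∃ b ∈ comp (-g), a * b = 1 ∧ b * a = 1

/-- The support of a graded subfield. -/
def GradedSubfield.support {κ : Type*} [AddCommGroup κ] {A : Type*} [Ring A]
    [Module F A] {𝒟 : κ → Submodule F A} (𝒦 : GradedSubfield 𝒟) : Set κ :=
  {k | 𝒦.comp k ≠ ⊥}

/-- A graded subfield is maximal if the only graded subfield containing it
is itself. -/
def GradedSubfield.IsMaximal {κ : Type*} [AddCommGroup κ] {A : Type*} [Ring A]
    [Module F A] {𝒟 : κ → Submodule F A} (𝒦 : GradedSubfield 𝒟) : Prop :=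
  ∀ 𝒦' : GradedSubfield 𝒟, (∀ k, 𝒦.comp k ≤ 𝒦'.comp k) → ∀ k, 𝒦'.comp k = 𝒦.comp k

/-- A graded subfield is isomorphic, as a graded algebra, to the group algebra
of its support: it has a homogeneous basis `c` (one-dimensional components)
which is multiplicative. -/
def GradedSubfield.IsGroupAlgebraOfSupport {κ : Type*} [AddCommGroup κ]
    {A : Type*} [Ring A] [Module F A] {𝒟 : κ → Submodule F A}
    (𝒦 : GradedSubfield 𝒟) : Prop :=
  ∃ c : κ → A, c 0 = 1 ∧
    (∀ k ∈ 𝒦.support, c k ∈ 𝒦.comp k ∧ c k ≠ 0 ∧ 𝒦.comp k = Submodule.span F {c k}) ∧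
    (∀ k₁ ∈ 𝒦.support, ∀ k₂ ∈ 𝒦.support, c (k₁ + k₂) = c k₁ * c k₂)

section Loop

variable {Q₁ Q₂ : Type*}

/-- The underlying space of the loop module: inside `V ⊗ F[Q₁] ≅ (Q₁ →₀ V)`,
the subspace `⊕_{a ∈ Q₁} V_{s a} ⊗ a` of finitely supported functions `f` with
`f a ∈ V_{s a}`. -/
def LoopSubmodule {V : Type*} [AddCommGroup V] [Module F V] (s : Q₁ → Q₂)
    (ℳ : Q₂ → Submodule F V) : Submodule F (Q₁ →₀ V) where
  carrier := {f | ∀ a : Q₁, f a ∈ ℳ (s a)}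
  add_mem' := fun hf hg a => by simpa using (ℳ _).add_mem (hf a) (hg a)
  zero_mem' := fun a => by simpa using (ℳ _).zero_mem
  smul_mem' := fun c f hf a => by simpa using (ℳ _).smul_mem c (hf a)

/-- The degree-`a` homogeneous component of the loop module. -/
def loopComp {V : Type*} [AddCommGroup V] [Module F V] (s : Q₁ → Q₂)
    (ℳ : Q₂ → Submodule F V) (a : Q₁) : Submodule F ↥(LoopSubmodule s ℳ) where
  carrier := {x | ∀ b : Q₁, b ≠ a → (x : Q₁ →₀ V) b = 0}
  add_mem' := by
    intro x y hx hy b hb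
    simp [hx b hb, hy b hb]
  zero_mem' := by intro b hb; simp
  smul_mem' := by
    intro c x hx b hb
    simp [hx b hb]

/-- The scalar multiplication of a (possibly non-canonical) module structure,
written explicitly. -/
def msmul {S M : Type*} [Semiring S] [AddCommMonoid M] (i : Module S M)
    (r : S) (x : M) : M :=
  @SMul.smul S M i.toDistribMulAction.toMulAction.toSMul r x

/-- `i` is the loop-module `R`-action: a homogeneous element `r ∈ R_g` acts on
`v ⊗ a` by `r • (v ⊗ a) = (r v) ⊗ (p g + a)`; in terms of values of finitely
supported functions, `(r • x) a = r • x (a - p g)`. -/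
def IsLoopSMul [AddCommGroup Q₁] (𝒜 : AlgebraGrading F G R) (p : G →+ Q₁)
    (s : Q₁ → Q₂) {V : Type*} [AddCommGroup V] [Module F V] [Module R V]
    (ℳ : Q₂ → Submodule F V) (i : Module R ↥(LoopSubmodule s ℳ)) : Prop :=
  ∀ {g : G} {r : R}, r ∈ 𝒜.comp g → ∀ (x : ↥(LoopSubmodule s ℳ)) (a : Q₁),
    ((msmul i r x : ↥(LoopSubmodule s ℳ)) : Q₁ →₀ V) a = r • ((x : Q₁ →₀ V) (a - p g))

/-- The right-shift operator `1 ⊗ d` on the loop module: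
`v ⊗ a ↦ v ⊗ (a + d)`. -/
def rshiftFun [AddCommGroup Q₁] {V : Type*} [AddCommGroup V] [Module F V]
    (s : Q₁ → Q₂) (ℳ : Q₂ → Submodule F V) (d : Q₁) (hd : ∀ a, s (a + d) = s a) :
    ↥(LoopSubmodule s ℳ) → ↥(LoopSubmodule s ℳ) :=
  fun x => ⟨Finsupp.equivMapDomain (Equiv.addRight d) (x : Q₁ →₀ V), by
    intro a
    have key : Finsupp.equivMapDomain (Equiv.addRight d) (x : Q₁ →₀ V) a
        = (x : Q₁ →₀ V) (a - d) := by
      rw [Finsupp.equivMapDomain_apply]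
      congr 1
      simp [sub_eq_add_neg]
    rw [key]
    have h1 : s (a - d) = s a := by
      have h2 := hd (a - d)
      rw [show a - d + d = a by abel] at h2
      exact h2.symm
    exact h1 ▸ x.2 (a - d)⟩

end Loop

section Twist

variable (H : AddSubgroup G)

/-- `i` is the `R`-module structure on (the finitely-supported-functions model
`{f : G/H →₀ V | f q ∈ V_q}` of) the `G/H`-graded module `V`, twisted by the
scalar factors `cf`: a homogeneous `r ∈ R_g` acts on `v ∈ V_k` by
`r • v = cf g k • (r v) ∈ V_{ḡ + k}`. -/
def IsTwistedSMul (𝒜 : AlgebraGrading F G R) {V : Type*} [AddCommGroup V]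
    [Module F V] [Module R V] (ℳ : G ⧸ H → Submodule F V) (cf : G → G ⧸ H → F)
    (i : Module R ↥(LoopSubmodule (id : G ⧸ H → G ⧸ H) ℳ)) : Prop :=
  ∀ {g : G} {r : R}, r ∈ 𝒜.comp g → ∀ (x : ↥(LoopSubmodule (id : G ⧸ H → G ⧸ H) ℳ))
    (q : G ⧸ H),
    ((msmul i r x : ↥(LoopSubmodule (id : G ⧸ H → G ⧸ H) ℳ)) : (G ⧸ H) →₀ V) q
      = cf g (q - QuotientAddGroup.mk g) •
          (r • ((x : (G ⧸ H) →₀ V) (q - QuotientAddGroup.mk g)))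

end Twist

section Pregrading

/-- A `G`-pregrading of the left `R`-module `V`: a family of subspaces with
`V = Σ_g V_g` and `R_g · V_h ⊆ V_{g+h}`. -/
def IsPregrading (𝒜 : AlgebraGrading F G R) {V : Type*} [AddCommGroup V]
    [Module F V] [Module R V] (P : G → Submodule F V) : Prop :=
  (⨆ g, P g) = (⊤ : Submodule F V) ∧
  ∀ {g k : G} {r : R} {v : V}, r ∈ 𝒜.comp g → v ∈ P k → r • v ∈ P (g + k)

/-- A pregrading is thin if it admits no proper refinement. -/
def IsThinPregrading (𝒜 : AlgebraGrading F G R) {V : Type*} [AddCommGroup V]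
    [Module F V] [Module R V] (P : G → Submodule F V) : Prop :=
  IsPregrading 𝒜 P ∧
  ∀ P' : G → Submodule F V, IsPregrading 𝒜 P' → (∀ g, P' g ≤ P g) → P' = P

end Pregrading

section Extras

open TensorProduct

variable {G : Type*} [AddCommGroup G] {R : Type*} [Ring R] [Algebra F R]

lemma mk'_add_right_mem (H : AddSubgroup G) (h : ↥H) (a : G) :
    (QuotientAddGroup.mk' H) (a + (h : G)) = (QuotientAddGroup.mk' H) a := by
  simpa using QuotientAddGroup.mk_add_of_mem a h.2

/-- The right-shift operator `1 ⊗ h`, `h ∈ H`, on the loop module `L_π(V)`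
(for `π : G → G/H` the natural projection): `v ⊗ g ↦ v ⊗ (g + h)`. -/
def loopShift (H : AddSubgroup G) {V : Type*} [AddCommGroup V] [Module F V]
    (ℳ : G ⧸ H → Submodule F V) (h : ↥H) :
    ↥(LoopSubmodule (⇑(QuotientAddGroup.mk' H)) ℳ) →
      ↥(LoopSubmodule (⇑(QuotientAddGroup.mk' H)) ℳ) :=
  rshiftFun (⇑(QuotientAddGroup.mk' H)) ℳ (h : G) (mk'_add_right_mem H h)

lemma twist_elt_mem (H : AddSubgroup G) (ξ : G ⧸ H → G)
    (hξ : ∀ q, (QuotientAddGroup.mk' H) (ξ q) = q) (g : G) (k : G ⧸ H) :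
    g + ξ k - ξ ((QuotientAddGroup.mk' H) g + k) ∈ H := by
  have h0 : (QuotientAddGroup.mk' H) (g + ξ k - ξ ((QuotientAddGroup.mk' H) g + k)) = 0 := by
    rw [map_sub, map_add, hξ, hξ]
    abel
  exact (QuotientAddGroup.eq_zero_iff _).mp h0

/-- The scalar factors `χ(g + ξ(k̄) - ξ(ḡ + k̄))` defining the module `V`
twisted by a character `χ` of `H`, relative to the section `ξ` of the natural
projection `π : G → G/H`. -/
def twistFactor (H : AddSubgroup G) (ξ : G ⧸ H → G)
    (hξ : ∀ q, (QuotientAddGroup.mk' H) (ξ q) = q) (χ : AddChar ↥H Fˣ) :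
    G → G ⧸ H → F :=
  fun g k =>
    ((χ ⟨g + ξ k - ξ ((QuotientAddGroup.mk' H) g + k), twist_elt_mem H ξ hξ g k⟩ : Fˣ) : F)

/-- The `G/H`-grading induced on a quotient `W/N` of a `G`-graded module `W`:
the component of degree `ḡ` is the image of `⊕_{h ∈ H} W_{g+h}`. -/
def quotGradeComp {W : Type*} [AddCommGroup W] [Module F W] [Module R W]
    [IsScalarTower F R W] (H : AddSubgroup G) (ℳ : G → Submodule F W)
    (N : Submodule R W) : G ⧸ H → Submodule F (W ⧸ N) :=
  fun q => ⨆ g : {g : G // (QuotientAddGroup.mk' H) g = q},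
    (ℳ (g : G)).map ((N.mkQ).restrictScalars F)

/-- The submodule `W · ker ρ` of `W`, where `ρ` is the homomorphism of unital
algebras `𝓕 → F` determined by `ρ(c_h) = ρ h` on the multiplicative
homogeneous basis `c` of the graded subfield `𝓕 ≅ FH` of the centralizer:
`W · ker ρ = Σ_{h ∈ H} W·(c_h - ρ(h)·1)`. -/
def kerSubmodule {W : Type*} [AddCommGroup W] [Module F W] [Module R W]
    [SMulCommClass R F W] {H : AddSubgroup G} (c : ↥H → Module.End R W)
    (ρ : ↥H → F) : Submodule R W :=
  ⨆ h : ↥H, LinearMap.range (c h - ρ h • (1 : Module.End R W))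

/-- The grading of the coordinate space `ι' → F` with coordinates of degrees
`gdeg`. -/
def coordComp {ι' : Type*} (gdeg : ι' → G) (g : G) : Submodule F (ι' → F) where
  carrier := {x | ∀ i, gdeg i ≠ g → x i = 0}
  add_mem' := fun hx hy i hi => by
    simp only [Pi.add_apply, hx i hi, hy i hi, add_zero]
  zero_mem' := fun i hi => rfl
  smul_mem' := fun a x hx i hi => by
    simp only [Pi.smul_apply, hx i hi, smul_zero]

/-- The natural grading of a tensor product of two graded algebras (or graded
vector spaces): the component of degree `g` is spanned by the products
`a ⊗ b` of homogeneous elements with `deg a + deg b = g`. -/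
def tensorGradeComp {A B : Type*} [AddCommGroup A] [Module F A] [AddCommGroup B]
    [Module F B] (Ac : G → Submodule F A) (Bc : G → Submodule F B) (g : G) :
    Submodule F (A ⊗[F] B) :=
  Submodule.span F {x | ∃ (g₁ g₂ : G) (a : A) (b : B),
    g₁ + g₂ = g ∧ a ∈ Ac g₁ ∧ b ∈ Bc g₂ ∧ x = a ⊗ₜ[F] b}

/-- The action of `r ∈ R` on an `R`-module `V`, viewed as an `F`-linear
endomorphism of `V`; i.e. the representation `R → End_F(V)`. -/
def actionEnd (F : Type*) [Field F] {R V : Type*} [Ring R] [AddCommGroup V]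
    [Module F V] [Module R V] [SMulCommClass R F V] (r : R) : Module.End F V where
  toFun v := r • v
  map_add' := smul_add r
  map_smul' a v := by simpa using smul_comm r a v

end Extras

end GradedPaper

namespace GradedPaper

theorem twist_iso_of_family {F : Type*} [Field F] {G : Type*} [AddCommGroup G]
    {R : Type*} [Ring R] [Algebra F R] (H : AddSubgroup G)
    {V : Type*} [AddCommGroup V] [Module F V] [Module R V] [IsScalarTower F R V]
    {V' : Type*} [AddCommGroup V'] [Module F V'] [Module R V'] [IsScalarTower F R V']
    (𝒜 : AlgebraGrading F G R)
    (𝒱 : ModuleGrading 𝒜 (QuotientAddGroup.mk' H) V)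
    (𝒱' : ModuleGrading 𝒜 (QuotientAddGroup.mk' H) V')
    (cf : G → G ⧸ H → F) (f : G ⧸ H → V → V')
    (hadd : ∀ q, ∀ v ∈ 𝒱.comp q, ∀ w ∈ 𝒱.comp q, f q (v + w) = f q v + f q w)
    (hmem : ∀ q, ∀ v ∈ 𝒱.comp q, f q v ∈ 𝒱'.comp q)
    (hinj : ∀ q, ∀ v ∈ 𝒱.comp q, f q v = 0 → v = 0)
    (hsurj : ∀ q, ∀ w ∈ 𝒱'.comp q, ∃ v ∈ 𝒱.comp q, f q v = w)
    (hr : ∀ (g : G) (r : R), r ∈ 𝒜.comp g → ∀ q, ∀ v ∈ 𝒱.comp q,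
      r • f q v = f ((g : G ⧸ H) + q) (cf g q • r • v))
    (iT : Module R ↥(LoopSubmodule (id : G ⧸ H → G ⧸ H) 𝒱.comp))
    (hT : IsTwistedSMul H 𝒜 𝒱.comp cf iT) :
    ∃ e : V' ≃ₗ[R] ↥(LoopSubmodule (id : G ⧸ H → G ⧸ H) 𝒱.comp),
          (∀ q : G ⧸ H, ∀ v ∈ 𝒱'.comp q,
            e v ∈ loopComp (id : G ⧸ H → G ⧸ H) 𝒱.comp q) ∧
          (∀ q : G ⧸ H, ∀ y ∈ loopComp (id : G ⧸ H → G ⧸ H) 𝒱.comp q,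
            e.symm y ∈ 𝒱'.comp q) := by
  classical
  have h0 : ∀ q, f q 0 = 0 := by
    intro q
    have := hadd q 0 (zero_mem _) 0 (zero_mem _)
    simpa using this
  have hsup : ∀ x : (G ⧸ H) →₀ V,
      (Function.support fun q => f q (x q)) ⊆ (x.support : Set (G ⧸ H)) := by
    intro x q hq
    simp only [Function.mem_support] at hq
    simp only [Finset.mem_coe, Finsupp.mem_support_iff]
    intro h
    exact hq (by rw [h, h0])
  have hfin : ∀ x : (G ⧸ H) →₀ V, (Function.support fun q => f q (x q)).Finite :=
    fun x => x.support.finite_toSet.subset (hsup x)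
  let E0 : ↥(LoopSubmodule (id : G ⧸ H → G ⧸ H) 𝒱.comp) →+ V' :=
    { toFun := fun x => ∑ᶠ q, f q ((x : (G ⧸ H) →₀ V) q)
      map_zero' := by simp [h0]
      map_add' := by
        intro x y
        rw [← finsum_add_distrib (hfin _) (hfin _)]
        exact finsum_congr fun q => hadd q _ (x.2 q) _ (y.2 q) }
  have hE0 : ∀ x, E0 x = ∑ᶠ q, f q ((x : (G ⧸ H) →₀ V) q) := fun x => rfl
  have hhom : ∀ (g : G) (r : R), r ∈ 𝒜.comp g → ∀ x, E0 (r • x) = r • E0 x := by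
    intro g r hrg x
    rw [hE0, hE0, smul_finsum' _ (hfin _)]
    rw [← finsum_comp_equiv (Equiv.addLeft (g : G ⧸ H))]
    refine finsum_congr fun q => ?_
    rw [hr g r hrg q _ (x.2 q)]
    have := hT hrg x ((g : G ⧸ H) + q)
    simp only [add_sub_cancel_left] at this
    exact congrArg _ this
  let E : ↥(LoopSubmodule (id : G ⧸ H → G ⧸ H) 𝒱.comp) →ₗ[R] V' :=
    { toFun := E0
      map_add' := E0.map_add
      map_smul' := by
        intro r x
        obtain ⟨t, c, hc, rfl⟩ := 𝒜.decomp.1 r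
        simp only [Finset.sum_smul, map_sum, RingHom.id_apply]
        exact Finset.sum_congr rfl fun i hi => hhom i _ (hc i hi) x }
  have hE : ∀ x, E x = ∑ᶠ q, f q ((x : (G ⧸ H) →₀ V) q) := fun x => rfl
  have hhit : ∀ q, ∀ w ∈ 𝒱'.comp q,
      ∃ x ∈ loopComp (id : G ⧸ H → G ⧸ H) 𝒱.comp q, E x = w := by
    intro q w hw
    obtain ⟨v, hv, rfl⟩ := hsurj q w hw
    refine ⟨⟨Finsupp.single q v, ?_⟩, ?_, ?_⟩
    · intro a
      by_cases h : q = a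
      · subst h; simpa using hv
      · simp [Finsupp.single_apply, h]
    · intro b hb
      simp [Finsupp.single_apply, hb.symm]
    · rw [hE, finsum_eq_single _ q]
      · simp
      · intro b hb
        simp [Finsupp.single_apply, hb.symm, h0]
  have hbij : Function.Bijective E := by
    constructor
    · rw [injective_iff_map_eq_zero]
      intro x hx
      rw [hE, finsum_eq_sum_of_support_subset _ (hsup _)] at hx
      have := 𝒱'.decomp.2 _ (fun q => f q ((x : (G ⧸ H) →₀ V) q))
        (fun q _ => hmem q _ (x.2 q)) hx
      ext q
      by_cases hq : q ∈ (x : (G ⧸ H) →₀ V).support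
      · exact hinj q _ (x.2 q) (this q hq)
      · simpa using hq
    · intro w
      obtain ⟨t, c, hc, rfl⟩ := 𝒱'.decomp.1 w
      have : ∀ q ∈ t, c q ∈ LinearMap.range E := by
        intro q hq
        obtain ⟨x, _, hx⟩ := hhit q _ (hc q hq)
        exact ⟨x, hx⟩
      exact Submodule.sum_mem _ this
  refine ⟨(LinearEquiv.ofBijective E hbij).symm, ?_, ?_⟩
  · intro q v hv
    obtain ⟨x, hx, rfl⟩ := hhit q v hv
    have : (LinearEquiv.ofBijective E hbij).symm (E x) = x :=
      (LinearEquiv.ofBijective E hbij).symm_apply_apply x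
    rw [this]; exact hx
  · intro q y hy
    change E y ∈ _
    rw [hE, finsum_eq_single _ q]
    · exact hmem q _ (y.2 q)
    · intro b hb
      rw [hy b hb, h0]

theorem loopShift_apply {F : Type*} [Field F] {G : Type*} [AddCommGroup G]
    (H : AddSubgroup G) {V : Type*} [AddCommGroup V] [Module F V]
    (ℳ : G ⧸ H → Submodule F V) (h : ↥H)
    (x : ↥(LoopSubmodule (⇑(QuotientAddGroup.mk' H)) ℳ)) (a : G) :
    ((loopShift H ℳ h x : ↥(LoopSubmodule (⇑(QuotientAddGroup.mk' H)) ℳ)) : G →₀ V) a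
      = (x : G →₀ V) (a - h) := by
  simp [loopShift, rshiftFun, Finsupp.equivMapDomain_apply, sub_eq_add_neg]

/-- The element `v ⊗ a` of the loop module. -/
def loopSingle {F : Type*} [Field F] {G : Type*} [AddCommGroup G]
    (H : AddSubgroup G) {V : Type*} [AddCommGroup V] [Module F V]
    (ℳ : G ⧸ H → Submodule F V) (a : G) (v : V) (hv : v ∈ ℳ (QuotientAddGroup.mk' H a)) :
    ↥(LoopSubmodule (⇑(QuotientAddGroup.mk' H)) ℳ) :=
  ⟨Finsupp.single a v, by
    classical
    intro b
    by_cases h : a = b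
    · subst h; simpa using hv
    · simp [Finsupp.single_apply, h]⟩

theorem loopSingle_mem {F : Type*} [Field F] {G : Type*} [AddCommGroup G]
    (H : AddSubgroup G) {V : Type*} [AddCommGroup V] [Module F V]
    (ℳ : G ⧸ H → Submodule F V) (a : G) (v : V) (hv : v ∈ ℳ (QuotientAddGroup.mk' H a)) :
    loopSingle H ℳ a v hv ∈ loopComp (⇑(QuotientAddGroup.mk' H)) ℳ a := by
  classical
  intro b hb
  simp [loopSingle, Finsupp.single_apply, hb.symm]

/-- A homogeneous element is determined by its value. -/
theorem loop_ext {F : Type*} [Field F] {G : Type*} [AddCommGroup G]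
    (H : AddSubgroup G) {V : Type*} [AddCommGroup V] [Module F V]
    (ℳ : G ⧸ H → Submodule F V) (a : G) 
    {x y : ↥(LoopSubmodule (⇑(QuotientAddGroup.mk' H)) ℳ)} 
    (hx : x ∈ loopComp (⇑(QuotientAddGroup.mk' H)) ℳ a)
    (hy : y ∈ loopComp (⇑(QuotientAddGroup.mk' H)) ℳ a)
    (h : (x : G →₀ V) a = (y : G →₀ V) a) : x = y := by
  ext b
  by_cases hb : b = a
  · subst hb; exact h
  · rw [hx b hb, hy b hb]

theorem loopShift_mem {F : Type*} [Field F] {G : Type*} [AddCommGroup G]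
    (H : AddSubgroup G) {V : Type*} [AddCommGroup V] [Module F V]
    (ℳ : G ⧸ H → Submodule F V) (h : ↥H) (a : G)
    {x : ↥(LoopSubmodule (⇑(QuotientAddGroup.mk' H)) ℳ)} 
    (hx : x ∈ loopComp (⇑(QuotientAddGroup.mk' H)) ℳ a) :
    loopShift H ℳ h x ∈ loopComp (⇑(QuotientAddGroup.mk' H)) ℳ (a + h) := by
  intro b hb
  rw [loopShift_apply]
  exact hx _ fun e => hb (by rw [← e]; abel)

theorem loop_algebraMap_smul {F : Type*} [Field F] {G : Type*} [AddCommGroup G]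
    {R : Type*} [Ring R] [Algebra F R] (H : AddSubgroup G)
    {V : Type*} [AddCommGroup V] [Module F V] [Module R V] [IsScalarTower F R V]
    (𝒜 : AlgebraGrading F G R) (ℳ : G ⧸ H → Submodule F V)
    (i₁ : Module R ↥(LoopSubmodule (⇑(QuotientAddGroup.mk' H)) ℳ))
    (h₁ : IsLoopSMul 𝒜 (AddMonoidHom.id G) (⇑(QuotientAddGroup.mk' H)) ℳ i₁)
    (a : F) (x : ↥(LoopSubmodule (⇑(QuotientAddGroup.mk' H)) ℳ)) :
    algebraMap F R a • x = a • x := by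
  have hm : algebraMap F R a ∈ 𝒜.comp 0 := by
    rw [Algebra.algebraMap_eq_smul_one]
    exact (𝒜.comp 0).smul_mem a 𝒜.one_mem
  ext b
  have := h₁ hm x b
  simp only [map_zero, sub_zero, algebraMap_smul] at this
  exact this


/-- Let `V, V'` be simple, central `G/H`-graded modules with
thin associated pregradings.  If there is a `G`-graded isomorphism
`φ : L_π(V) ≅ L_π(V')` whose conjugation maps `span{δ_h}` onto `span{δ'_h}`,
then `V'` is isomorphic to a twist `V^χ` for some character `χ` of `H`. -/
theorem statement11 {F : Type*} [Field F] {G : Type*} [AddCommGroup G]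
    {R : Type*} [Ring R] [Algebra F R] (H : AddSubgroup G)
    (ξ : G ⧸ H → G) (hξ : ∀ q, (QuotientAddGroup.mk' H) (ξ q) = q)
    {V : Type*} [AddCommGroup V] [Module F V] [Module R V] [IsScalarTower F R V]
    {V' : Type*} [AddCommGroup V'] [Module F V'] [Module R V'] [IsScalarTower F R V']
    (𝒜 : AlgebraGrading F G R)
    (𝒱 : ModuleGrading 𝒜 (QuotientAddGroup.mk' H) V)
    (𝒱' : ModuleGrading 𝒜 (QuotientAddGroup.mk' H) V')
    (hV : IsSimpleModule R V) (hVc : IsCentralModule F R V)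
    (hVthin : IsThinPregrading 𝒜 (fun g : G => 𝒱.comp ((QuotientAddGroup.mk' H) g)))
    (hV' : IsSimpleModule R V') (hV'c : IsCentralModule F R V')
    (hV'thin : IsThinPregrading 𝒜 (fun g : G => 𝒱'.comp ((QuotientAddGroup.mk' H) g)))
    (i₁ : Module R ↥(LoopSubmodule (⇑(QuotientAddGroup.mk' H)) 𝒱.comp))
    (h₁ : IsLoopSMul 𝒜 (AddMonoidHom.id G) (⇑(QuotientAddGroup.mk' H)) 𝒱.comp i₁)
    (i₂ : Module R ↥(LoopSubmodule (⇑(QuotientAddGroup.mk' H)) 𝒱'.comp))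
    (h₂ : IsLoopSMul 𝒜 (AddMonoidHom.id G) (⇑(QuotientAddGroup.mk' H)) 𝒱'.comp i₂)
    (φ : ↥(LoopSubmodule (⇑(QuotientAddGroup.mk' H)) 𝒱.comp) ≃ₗ[R]
        ↥(LoopSubmodule (⇑(QuotientAddGroup.mk' H)) 𝒱'.comp))
    (hφgr : ∀ g : G, ∀ x ∈ loopComp (⇑(QuotientAddGroup.mk' H)) 𝒱.comp g,
      φ x ∈ loopComp (⇑(QuotientAddGroup.mk' H)) 𝒱'.comp g)
    (hφgr' : ∀ g : G, ∀ y ∈ loopComp (⇑(QuotientAddGroup.mk' H)) 𝒱'.comp g,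
      φ.symm y ∈ loopComp (⇑(QuotientAddGroup.mk' H)) 𝒱.comp g)
    (hconj : ∀ h : ↥H, ∃ (t : Finset ↥H) (a : ↥H → F),
      ∀ y, φ (loopShift H 𝒱.comp h (φ.symm y)) = ∑ h' ∈ t, a h' • loopShift H 𝒱'.comp h' y)
    (hconj' : ∀ h : ↥H, ∃ (t : Finset ↥H) (a : ↥H → F),
      ∀ x, φ.symm (loopShift H 𝒱'.comp h (φ x)) = ∑ h' ∈ t, a h' • loopShift H 𝒱.comp h' x) :
    ∃ χ : AddChar ↥H Fˣ,
      ∀ iT : Module R ↥(LoopSubmodule (id : G ⧸ H → G ⧸ H) 𝒱.comp),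
        IsTwistedSMul H 𝒜 𝒱.comp (twistFactor H ξ hξ χ) iT →
        ∃ e : V' ≃ₗ[R] ↥(LoopSubmodule (id : G ⧸ H → G ⧸ H) 𝒱.comp),
          (∀ q : G ⧸ H, ∀ v ∈ 𝒱'.comp q,
            e v ∈ loopComp (id : G ⧸ H → G ⧸ H) 𝒱.comp q) ∧
          (∀ q : G ⧸ H, ∀ y ∈ loopComp (id : G ⧸ H → G ⧸ H) 𝒱.comp q,
            e.symm y ∈ 𝒱'.comp q) := by
  classical
  have hF : ∀ (a : F) x, φ (a • x) = a • φ x := by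
    intro a x
    rw [← loop_algebraMap_smul H 𝒜 𝒱.comp i₁ h₁, map_smul,
      loop_algebraMap_smul H 𝒜 𝒱'.comp i₂ h₂]
  -- a nonzero homogeneous vector of `V'`
  obtain ⟨q₀, w₀, hw₀, hw₀0⟩ : ∃ q, ∃ w ∈ 𝒱'.comp q, w ≠ 0 := by
    have := IsSimpleModule.nontrivial R V'
    obtain ⟨w, hw⟩ := exists_ne (0 : V')
    by_contra! hcon
    obtain ⟨t, c, hc, rfl⟩ := 𝒱'.decomp.1 w
    exact hw (Finset.sum_eq_zero fun i hi => hcon i _ (hc i hi))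
  have hw₀' : w₀ ∈ 𝒱'.comp (QuotientAddGroup.mk' H (ξ q₀)) := by rw [hξ]; exact hw₀
  set y₀ := loopSingle H 𝒱'.comp (ξ q₀) w₀ hw₀' with hy₀
  have hy₀m : y₀ ∈ loopComp (⇑(QuotientAddGroup.mk' H)) 𝒱'.comp (ξ q₀) :=
    loopSingle_mem _ _ _ _ _
  have hy₀v : ((y₀ : ↥(LoopSubmodule (⇑(QuotientAddGroup.mk' H)) 𝒱'.comp)) : G →₀ V')
      (ξ q₀) = w₀ := by
    simp [hy₀, loopSingle]
  have hy₀0 : y₀ ≠ 0 := by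
    intro h
    rw [h] at hy₀v
    exact hw₀0 (by simpa using hy₀v.symm)
  have hc : ∀ h : ↥H, ∃ c : F, ∀ x, φ (loopShift H 𝒱.comp h x)
      = c • loopShift H 𝒱'.comp h (φ x) := by
    intro h
    obtain ⟨t, a, ha⟩ := hconj h
    have hz : ∀ h' ∈ t, h' ≠ h → a h' = 0 := by
      intro h' ht hne
      have h1 : φ (loopShift H 𝒱.comp h (φ.symm y₀)) ∈
          loopComp (⇑(QuotientAddGroup.mk' H)) 𝒱'.comp (ξ q₀ + h) :=
        hφgr _ _ (loopShift_mem _ _ _ _ (hφgr' _ _ hy₀m))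
      have h2 := h1 (ξ q₀ + h') (by simpa using hne)
      rw [ha] at h2
      simp only [Submodule.coe_sum, Submodule.coe_smul, Finsupp.coe_finsetSum,
        Finset.sum_apply, Finsupp.smul_apply, loopShift_apply] at h2
      rw [Finset.sum_eq_single h'] at h2
      · simpa [hy₀v, hw₀0] using h2
      · intro b _ hb
        rw [hy₀m _ _, smul_zero]
        intro e
        apply hb
        have : (h' : G) - b = 0 := by
          have e2 : ξ q₀ + (h' - b : G) = ξ q₀ := (add_sub_assoc _ _ _).symm.trans e
          simpa using e2
        exact (Subtype.ext (sub_eq_zero.mp this)).symm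
      · intro hn; exact absurd ht hn
    refine ⟨if h ∈ t then a h else 0, fun x => ?_⟩
    have := ha (φ x)
    rw [φ.symm_apply_apply] at this
    rw [this]
    split_ifs with hht
    · rw [Finset.sum_eq_single h]
      · intro b hb hbh
        rw [hz b hb hbh, zero_smul]
      · intro hn; exact absurd hht hn
    · rw [zero_smul]
      refine Finset.sum_eq_zero fun b hb => ?_
      rw [hz b hb (fun e => hht (e ▸ hb)), zero_smul]
  choose c hc using hc
  have hshift0 : ∀ x, loopShift H 𝒱.comp 0 x = x := by
    intro x; ext a; rw [loopShift_apply]; simp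
  have hshift0' : ∀ x, loopShift H 𝒱'.comp 0 x = x := by
    intro x; ext a; rw [loopShift_apply]; simp
  have hshiftadd : ∀ h k x, loopShift H 𝒱.comp (h + k) x
      = loopShift H 𝒱.comp h (loopShift H 𝒱.comp k x) := by
    intro h k x; ext a; simp only [loopShift_apply]; congr 1; push_cast; abel
  have hshiftadd' : ∀ h k x, loopShift H 𝒱'.comp (h + k) x
      = loopShift H 𝒱'.comp h (loopShift H 𝒱'.comp k x) := by
    intro h k x; ext a; simp only [loopShift_apply]; congr 1; push_cast; abel
  have hshiftsmul' : ∀ h (a : F) x, loopShift H 𝒱'.comp h (a • x)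
      = a • loopShift H 𝒱'.comp h x := by
    intro h a x; ext b
    rw [loopShift_apply, Submodule.coe_smul, Submodule.coe_smul, Finsupp.smul_apply,
      Finsupp.smul_apply, loopShift_apply]
  have hcancel : ∀ (h : ↥H) (a b : F),
      a • loopShift H 𝒱'.comp h y₀ = b • loopShift H 𝒱'.comp h y₀ → a = b := by
    intro h a b hab
    have h2 := congrArg (fun z : ↥(LoopSubmodule (⇑(QuotientAddGroup.mk' H)) 𝒱'.comp) =>
      (z : G →₀ V') (ξ q₀ + h)) hab
    simp only [Submodule.coe_smul, Finsupp.smul_apply, loopShift_apply,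
      add_sub_cancel_right, hy₀v] at h2
    exact smul_left_injective F hw₀0 h2
  have hc0 : c 0 = 1 := by
    apply hcancel 0
    have := hc 0 (φ.symm y₀)
    rw [hshift0, φ.apply_symm_apply] at this
    rw [← this, hshift0', one_smul]
  have hcadd : ∀ h k, c (h + k) = c h * c k := by
    intro h k
    apply hcancel (h + k)
    have := hc (h + k) (φ.symm y₀)
    rw [hshiftadd, hc, hc, φ.apply_symm_apply, hshiftsmul', ← hshiftadd', smul_smul] at this
    exact this.symm
  let χ₀ : AddChar ↥H F :=
    { toFun := c
      map_zero_eq_one' := hc0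
      map_add_eq_mul' := hcadd }
  have hcu : ∀ h, c h * c (-h) = 1 := by
    intro h; rw [← hcadd, add_neg_cancel, hc0]
  let χ : AddChar ↥H Fˣ :=
    { toFun := fun h => ⟨c h, c (-h), hcu h, by rw [mul_comm]; exact hcu h⟩
      map_zero_eq_one' := Units.ext hc0
      map_add_eq_mul' := fun h k => Units.ext (hcadd h k) }
  have hχ : ∀ h, ((χ h : Fˣ) : F) = c h := fun h => rfl
  have hm : ∀ {q v}, v ∈ 𝒱.comp q → v ∈ 𝒱.comp (QuotientAddGroup.mk' H (ξ q)) := by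
    intro q v hv; rw [hξ]; exact hv
  have hm' : ∀ {q v}, v ∈ 𝒱'.comp q → v ∈ 𝒱'.comp (QuotientAddGroup.mk' H (ξ q)) := by
    intro q v hv; rw [hξ]; exact hv
  let f : G ⧸ H → V → V' := fun q v =>
    if hv : v ∈ 𝒱.comp q then
      ((φ (loopSingle H 𝒱.comp (ξ q) v (hm hv)) :
        ↥(LoopSubmodule (⇑(QuotientAddGroup.mk' H)) 𝒱'.comp)) : G →₀ V') (ξ q)
    else 0
  have hf : ∀ q v (hv : v ∈ 𝒱.comp q), f q v =
      ((φ (loopSingle H 𝒱.comp (ξ q) v (hm hv)) :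
        ↥(LoopSubmodule (⇑(QuotientAddGroup.mk' H)) 𝒱'.comp)) : G →₀ V') (ξ q) := by
    intro q v hv
    exact dif_pos hv
  refine ⟨χ, fun iT hT => twist_iso_of_family H 𝒜 𝒱 𝒱' (twistFactor H ξ hξ χ) f
    ?_ ?_ ?_ ?_ ?_ iT hT⟩
  · intro q v hv w hw
    rw [hf q v hv, hf q w hw, hf q _ (add_mem hv hw), ← Finsupp.add_apply,
      ← Submodule.coe_add, ← map_add]
    congr 3
    apply Subtype.ext
    rw [Submodule.coe_add]
    exact Finsupp.single_add _ _ _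
  · intro q v hv
    rw [hf q v hv]
    have := (φ (loopSingle H 𝒱.comp (ξ q) v (hm hv))).2 (ξ q)
    rw [hξ] at this
    exact this
  · intro q v hv h
    rw [hf q v hv] at h
    have h1 : φ (loopSingle H 𝒱.comp (ξ q) v (hm hv)) = 0 :=
      loop_ext H 𝒱'.comp (ξ q) (hφgr _ _ (loopSingle_mem _ _ _ _ _)) (zero_mem _)
        (by simpa using h)
    have h2 := (LinearEquiv.map_eq_zero_iff φ).mp h1
    have h3 := congrArg (fun z : ↥(LoopSubmodule (⇑(QuotientAddGroup.mk' H)) 𝒱.comp) =>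
      (z : G →₀ V) (ξ q)) h2
    simpa [loopSingle] using h3
  · intro q w hw
    set x := φ.symm (loopSingle H 𝒱'.comp (ξ q) w (hm' hw)) with hx
    have hxm : x ∈ loopComp (⇑(QuotientAddGroup.mk' H)) 𝒱.comp (ξ q) :=
      hφgr' _ _ (loopSingle_mem _ _ _ _ _)
    have hv : (x : G →₀ V) (ξ q) ∈ 𝒱.comp q := by
      have := x.2 (ξ q)
      rw [hξ] at this
      exact this
    refine ⟨_, hv, ?_⟩
    rw [hf q _ hv]
    have : loopSingle H 𝒱.comp (ξ q) _ (hm hv) = x :=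
      loop_ext H 𝒱.comp (ξ q) (loopSingle_mem _ _ _ _ _) hxm (by simp [loopSingle])
    rw [this, hx, φ.apply_symm_apply]
    simp [loopSingle]
  · intro g r hrg q v hv
    have hrv : r • v ∈ 𝒱.comp ((g : G ⧸ H) + q) := 𝒱.smul_mem hrg hv
    set h : ↥H := ⟨g + ξ q - ξ ((QuotientAddGroup.mk' H) g + q), twist_elt_mem H ξ hξ g q⟩
      with hh
    have hcf : twistFactor H ξ hξ χ g q = c h := rfl
    have hhv : (h : G) = g + ξ q - ξ ((g : G ⧸ H) + q) := rfl
    have hsm : twistFactor H ξ hξ χ g q • r • v ∈ 𝒱.comp ((g : G ⧸ H) + q) :=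
      Submodule.smul_mem _ _ hrv
    rw [hf q v hv, hf _ _ hsm]
    have e1 : loopSingle H 𝒱.comp (ξ ((g : G ⧸ H) + q)) _ (hm hsm)
        = c h • loopSingle H 𝒱.comp (ξ ((g : G ⧸ H) + q)) _ (hm hrv) := by
      apply Subtype.ext
      rw [Submodule.coe_smul]
      exact (Finsupp.smul_single _ _ _).symm
    have e2 : loopShift H 𝒱.comp h (loopSingle H 𝒱.comp (ξ ((g : G ⧸ H) + q)) _ (hm hrv))
        = r • loopSingle H 𝒱.comp (ξ q) v (hm hv) := by
      ext b
      rw [loopShift_apply]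
      refine Eq.trans ?_ (h₁ hrg _ b).symm
      simp only [loopSingle, AddMonoidHom.id_apply, Finsupp.single_apply, hhv]
      have : ξ ((g : G ⧸ H) + q) = b - (g + ξ q - ξ ((g : G ⧸ H) + q)) ↔ ξ q = b - g := by
        constructor
        · intro e
          have : b = g + ξ q := by
            rw [eq_sub_iff_add_eq] at e
            rw [← e]; abel
          rw [this]; abel
        · intro e
          rw [e]; abel
      by_cases hb : ξ q = b - g
      · rw [if_pos (this.mpr hb), if_pos hb]
      · rw [if_neg (fun e => hb (this.mp e)), if_neg hb, smul_zero]
    have e3 := hc h (loopSingle H 𝒱.comp (ξ ((g : G ⧸ H) + q)) _ (hm hrv))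
    rw [e2, map_smul] at e3
    have e4 := congrArg (fun z : ↥(LoopSubmodule (⇑(QuotientAddGroup.mk' H)) 𝒱'.comp) =>
      (z : G →₀ V') (g + ξ q)) e3
    simp only [Submodule.coe_smul, Finsupp.smul_apply, loopShift_apply, hhv, sub_sub_cancel] at e4
    have e5 := h₂ hrg (φ (loopSingle H 𝒱.comp (ξ q) v (hm hv))) (g + ξ q)
    simp only [AddMonoidHom.id_apply, add_sub_cancel_left] at e5
    rw [e1, hF, ← e5]
    exact e4


end GradedPaper
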